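/- arXiv:1108.5608 — 2 statements merged into one kernel-verified Lean document; each statement's English description precedes it below -/
import Mathlib

section
/- Let (Ω, ℱ, μ) be a probability space and A, B : Ω → ℝ measurable with 0 < A(ω) ≤ B(ω) for μ-a.e. ω, μ({ω : A(ω) < B(ω)}) > 0, and ω ↦ A(ω)⁻¹ integrable; let g(γ) = ∫ A(ω)^(γ−1) · B(ω)^(−γ) dμ(ω) for γ ∈ [0,1]. Then for every real c with g(1) ≤ c ≤ g(0) there exists a unique γ ∈ [0,1] with g(γ) = c. -/
open MeasureTheory Real

lemma rpow_sub_one_mul_rpow_neg {a b : ℝ} (ha : 0 < a) (hb : 0 < b) (γ : ℝ) :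
    a ^ (γ - 1) * b ^ (-γ) = a⁻¹ * (a / b) ^ γ := by
  rw [rpow_sub_one ha.ne', rpow_neg hb.le, div_rpow ha.le hb.le]
  ring

lemma rpow_sub_one_mul_rpow_neg_antitone {a b : ℝ} (ha : 0 < a) (hab : a ≤ b) :
    Antitone fun γ : ℝ => a ^ (γ - 1) * b ^ (-γ) := by
  have hb := ha.trans_le hab
  intro x y hxy
  simp only [rpow_sub_one_mul_rpow_neg ha hb]
  exact mul_le_mul_of_nonneg_left (rpow_le_rpow_of_exponent_ge (div_pos ha hb)
    ((div_le_one hb).2 hab) hxy) (inv_nonneg.2 ha.le)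

lemma rpow_sub_one_mul_rpow_neg_strictAnti {a b : ℝ} (ha : 0 < a) (hab : a < b) :
    StrictAnti fun γ : ℝ => a ^ (γ - 1) * b ^ (-γ) := by
  have hb := ha.trans hab
  intro x y hxy
  simp only [rpow_sub_one_mul_rpow_neg ha hb]
  exact mul_lt_mul_of_pos_left (rpow_lt_rpow_of_exponent_gt (div_pos ha hb)
    ((div_lt_one hb).2 hab) hxy) (inv_pos.2 ha)

lemma norm_rpow_sub_one_mul_rpow_neg_le {a b γ : ℝ} (ha : 0 < a) (hab : a ≤ b) (hγ : 0 ≤ γ) :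
    ‖a ^ (γ - 1) * b ^ (-γ)‖ ≤ a⁻¹ := by
  have hb := ha.trans_le hab
  rw [Real.norm_of_nonneg (by positivity)]
  simpa [rpow_neg_one] using rpow_sub_one_mul_rpow_neg_antitone ha hab hγ

section

variable {Ω : Type*} [MeasurableSpace Ω] {μ : Measure Ω} {A B : Ω → ℝ}

lemma integrable_rpow_sub_one_mul_rpow_neg (hA : Measurable A) (hB : Measurable B)
    (hAB : ∀ᵐ ω ∂μ, 0 < A ω ∧ A ω ≤ B ω) (hint : Integrable (fun ω => (A ω)⁻¹) μ)
    {γ : ℝ} (hγ : 0 ≤ γ) :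
    Integrable (fun ω => A ω ^ (γ - 1) * B ω ^ (-γ)) μ :=
  hint.mono' (by fun_prop)
    (hAB.mono fun _ h => norm_rpow_sub_one_mul_rpow_neg_le h.1 h.2 hγ)

lemma continuousOn_integral_rpow_sub_one_mul_rpow_neg (hA : Measurable A) (hB : Measurable B)
    (hAB : ∀ᵐ ω ∂μ, 0 < A ω ∧ A ω ≤ B ω) (hint : Integrable (fun ω => (A ω)⁻¹) μ) :
    ContinuousOn (fun γ : ℝ => ∫ ω, A ω ^ (γ - 1) * B ω ^ (-γ) ∂μ) (Set.Ici 0) := by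
  refine continuousOn_of_dominated (fun _ _ => by fun_prop)
    (fun _ hγ => hAB.mono fun _ h => norm_rpow_sub_one_mul_rpow_neg_le h.1 h.2 hγ) hint
    (hAB.mono fun ω h => Continuous.continuousOn ?_)
  have hb := h.1.trans_le h.2
  exact (continuous_const.rpow (by fun_prop) fun _ => Or.inl h.1.ne').mul
    (continuous_const.rpow (by fun_prop) fun _ => Or.inl hb.ne')

lemma strictAntiOn_integral_rpow_sub_one_mul_rpow_neg (hA : Measurable A) (hB : Measurable B)
    (hAB : ∀ᵐ ω ∂μ, 0 < A ω ∧ A ω ≤ B ω) (hpos : 0 < μ {ω | A ω < B ω})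
    (hint : Integrable (fun ω => (A ω)⁻¹) μ) :
    StrictAntiOn (fun γ : ℝ => ∫ ω, A ω ^ (γ - 1) * B ω ^ (-γ) ∂μ) (Set.Ici 0) := by
  intro x hx y hy hxy
  have hix := integrable_rpow_sub_one_mul_rpow_neg hA hB hAB hint hx
  have hiy := integrable_rpow_sub_one_mul_rpow_neg hA hB hAB hint hy
  have hle : (fun ω => A ω ^ (y - 1) * B ω ^ (-y)) ≤ᵐ[μ]
      fun ω => A ω ^ (x - 1) * B ω ^ (-x) :=
    hAB.mono fun _ h => rpow_sub_one_mul_rpow_neg_antitone h.1 h.2 hxy.le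
  refine (integral_mono_ae hiy hix hle).lt_of_ne fun heq => hpos.ne' ?_
  have hae : ∀ᵐ ω ∂μ, ¬ A ω < B ω := by
    filter_upwards [hAB, (integral_eq_iff_of_ae_le hiy hix hle).1 heq] with ω h hω hlt
    exact (rpow_sub_one_mul_rpow_neg_strictAnti h.1 hlt hxy).ne hω
  simpa [ae_iff] using hae

end

/-- Existence and uniqueness of the interpolation parameter: for every
`c` between `g(1)` and `g(0)` there is a unique `γ ∈ [0,1]` with `g(γ) = c`,
where `g(γ) = ∫ A^(γ-1) * B^(-γ) dμ`. -/
theorem spotLibor_interpolation_parameter_existsUnique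
    {Ω : Type*} [MeasurableSpace Ω] (μ : Measure Ω) [IsProbabilityMeasure μ]
    (A B : Ω → ℝ) (hA : Measurable A) (hB : Measurable B)
    (hAB : ∀ᵐ ω ∂μ, 0 < A ω ∧ A ω ≤ B ω)
    (hpos : 0 < μ {ω | A ω < B ω})
    (hint : Integrable (fun ω => (A ω)⁻¹) μ)
    (g : ℝ → ℝ) (hg : ∀ γ : ℝ, g γ = ∫ ω, A ω ^ (γ - 1) * B ω ^ (-γ) ∂μ) :
    ∀ c : ℝ, g 1 ≤ c → c ≤ g 0 →
      ∃! γ : ℝ, γ ∈ Set.Icc (0 : ℝ) 1 ∧ g γ = c := by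
  intro c hc1 hc0
  obtain rfl : g = fun γ => ∫ ω, A ω ^ (γ - 1) * B ω ^ (-γ) ∂μ := funext hg
  have hcont := (continuousOn_integral_rpow_sub_one_mul_rpow_neg hA hB hAB hint).mono
    (Set.Icc_subset_Ici_self : Set.Icc (0 : ℝ) 1 ⊆ Set.Ici 0)
  obtain ⟨γ, hγ, hγc⟩ := intermediate_value_Icc' zero_le_one hcont ⟨hc1, hc0⟩
  exact ⟨γ, ⟨hγ, hγc⟩, fun γ' ⟨hγ', hγc'⟩ =>
    (strictAntiOn_integral_rpow_sub_one_mul_rpow_neg hA hB hAB hpos hint).injOn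
      hγ'.1 hγ.1 (hγc'.trans hγc.symm)⟩
end

section
/- In the setting of the interpolation step — (Ω, ℱ, μ) a probability space, A, B : Ω → ℝ measurable with 0 < A ≤ B a.e., μ({A < B}) > 0, A⁻¹ integrable, T_n < T_{n+1}, B₀ : [T_n, T_{n+1}] → ℝ continuous strictly decreasing with B₀(T_n) = ∫ A⁻¹ dμ, B₀(T_{n+1}) = ∫ A⁻¹·(B/A)^(−1)... i.e. B₀(T_{n+1}) = ∫ B⁻¹ dμ, and γ : [T_n, T_{n+1}] → [0,1] the unique function with ∫ A^(γ(T)−1)·B^(−γ(T)) dμ = B₀(T) for all T — for μ-a.e. ω the path T ↦ A(ω)^(1−γ(T)) · B(ω)^(γ(T)) is monotone nondecreasing on [T_n, T_{n+1}] and takes values in the interval [A(ω), B(ω)], equalling A(ω) at T = T_n and B(ω) at T = T_{n+1}. -/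
open MeasureTheory Real

lemma rpow_mul_rpow_eq_mul_div_rpow {a b : ℝ} (ha : 0 < a) (hb : 0 < b) (g : ℝ) :
    a ^ (1 - g) * b ^ g = a * (b / a) ^ g := by
  rw [rpow_sub ha, rpow_one, div_rpow hb.le ha.le]
  ring

lemma rpow_mul_rpow_neg_eq_inv_mul_div_rpow {a b : ℝ} (ha : 0 < a) (hb : 0 < b) (g : ℝ) :
    a ^ (g - 1) * b ^ (-g) = a⁻¹ * (b / a) ^ (-g) := by
  rw [rpow_sub ha, rpow_one, div_rpow hb.le ha.le, rpow_neg ha.le]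
  field_simp

lemma monotone_rpow_mul_rpow {a b : ℝ} (ha : 0 < a) (hab : a ≤ b) :
    Monotone fun g : ℝ => a ^ (1 - g) * b ^ g := by
  intro g h hgh
  simp only [rpow_mul_rpow_eq_mul_div_rpow ha (ha.trans_le hab)]
  have h1 : 1 ≤ b / a := (one_le_div ha).2 hab
  gcongr

lemma antitone_rpow_mul_rpow_neg {a b : ℝ} (ha : 0 < a) (hab : a ≤ b) :
    Antitone fun g : ℝ => a ^ (g - 1) * b ^ (-g) := by
  intro g h hgh
  simp only [rpow_mul_rpow_neg_eq_inv_mul_div_rpow ha (ha.trans_le hab)]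
  have h1 : 1 ≤ b / a := (one_le_div ha).2 hab
  gcongr

lemma strictAnti_rpow_mul_rpow_neg {a b : ℝ} (ha : 0 < a) (hab : a < b) :
    StrictAnti fun g : ℝ => a ^ (g - 1) * b ^ (-g) := by
  intro g h hgh
  simp only [rpow_mul_rpow_neg_eq_inv_mul_div_rpow ha (ha.trans hab)]
  have h1 : 1 < b / a := (one_lt_div ha).2 hab
  exact mul_lt_mul_of_pos_left (rpow_lt_rpow_of_exponent_lt h1 (neg_lt_neg hgh)) (inv_pos.2 ha)

/-- For nonnegative parameters, the deflated interpolation is dominated by `A⁻¹`. -/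
lemma integrable_rpow_mul_rpow_neg {Ω : Type*} [MeasurableSpace Ω] {μ : Measure Ω}
    {A B : Ω → ℝ} (hA : Measurable A) (hB : Measurable B)
    (hAB : ∀ᵐ ω ∂μ, 0 < A ω ∧ A ω ≤ B ω) (hint : Integrable (fun ω => (A ω)⁻¹) μ)
    {g : ℝ} (hg : 0 ≤ g) :
    Integrable (fun ω => A ω ^ (g - 1) * B ω ^ (-g)) μ := by
  refine hint.mono' ((hA.pow_const _).mul (hB.pow_const _)).aestronglyMeasurable ?_
  filter_upwards [hAB] with ω ⟨ha, hab⟩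
  have hb : 0 < B ω := ha.trans_le hab
  rw [Real.norm_of_nonneg (by positivity)]
  simpa [rpow_neg_one] using antitone_rpow_mul_rpow_neg ha hab hg

lemma strictAntiOn_integral_rpow_mul_rpow_neg {Ω : Type*} [MeasurableSpace Ω] {μ : Measure Ω}
    {A B : Ω → ℝ} (hA : Measurable A) (hB : Measurable B)
    (hAB : ∀ᵐ ω ∂μ, 0 < A ω ∧ A ω ≤ B ω) (hpos : 0 < μ {ω | A ω < B ω})
    (hint : Integrable (fun ω => (A ω)⁻¹) μ) :
    StrictAntiOn (fun g : ℝ => ∫ ω, A ω ^ (g - 1) * B ω ^ (-g) ∂μ) (Set.Ici 0) := by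
  intro g hg h hh hgh
  have hig := integrable_rpow_mul_rpow_neg hA hB hAB hint hg
  have hih := integrable_rpow_mul_rpow_neg hA hB hAB hint hh
  rw [← sub_pos, ← integral_sub hig hih]
  refine (integral_pos_iff_support_of_nonneg_ae ?_ (hig.sub hih)).2 ?_
  · filter_upwards [hAB] with ω ⟨ha, hab⟩
    exact sub_nonneg.2 (antitone_rpow_mul_rpow_neg ha hab hgh.le)
  · refine hpos.trans_le (measure_mono_ae ?_)
    filter_upwards [hAB] with ω ⟨ha, _⟩ hlt
    exact (sub_pos.2 (strictAnti_rpow_mul_rpow_neg ha hlt hgh)).ne'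

/-- Pathwise consistency of the interpolated spot-LIBOR numeraire: with `γ` the unique
interpolation parameter function matching the initial term structure `B₀` (whose endpoint
values are `∫ A⁻¹ dμ` and `∫ B⁻¹ dμ`), a.e. path `T ↦ A^(1-γ(T)) * B^(γ(T))` is monotone
nondecreasing on `[Tₙ, Tₙ₊₁]`, takes values in `[A, B]`, and equals `A` at `Tₙ` and `B`
at `Tₙ₊₁`. -/
theorem spotLibor_interpolated_numeraire_pathwise
    {Ω : Type*} [MeasurableSpace Ω] (μ : Measure Ω) [IsProbabilityMeasure μ]
    (A B : Ω → ℝ) (hA : Measurable A) (hB : Measurable B)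
    (hAB : ∀ᵐ ω ∂μ, 0 < A ω ∧ A ω ≤ B ω)
    (hpos : 0 < μ {ω | A ω < B ω})
    (hint : Integrable (fun ω => (A ω)⁻¹) μ)
    (Tn Tn1 : ℝ) (hT : Tn < Tn1) (B₀ : ℝ → ℝ)
    (hB₀cont : ContinuousOn B₀ (Set.Icc Tn Tn1))
    (hB₀anti : StrictAntiOn B₀ (Set.Icc Tn Tn1))
    (hB₀n : B₀ Tn = ∫ ω, (A ω)⁻¹ ∂μ) (hB₀n1 : B₀ Tn1 = ∫ ω, (B ω)⁻¹ ∂μ)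
    (γf : ℝ → ℝ)
    (hγf : ∀ T ∈ Set.Icc Tn Tn1, γf T ∈ Set.Icc (0 : ℝ) 1 ∧
      (∫ ω, A ω ^ (γf T - 1) * B ω ^ (-(γf T)) ∂μ) = B₀ T) :
    ∀ᵐ ω ∂μ,
      MonotoneOn (fun T : ℝ => A ω ^ (1 - γf T) * B ω ^ (γf T)) (Set.Icc Tn Tn1) ∧
      (∀ T ∈ Set.Icc Tn Tn1,
        A ω ^ (1 - γf T) * B ω ^ (γf T) ∈ Set.Icc (A ω) (B ω)) ∧
      A ω ^ (1 - γf Tn) * B ω ^ (γf Tn) = A ω ∧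
      A ω ^ (1 - γf Tn1) * B ω ^ (γf Tn1) = B ω := by
  have hanti := strictAntiOn_integral_rpow_mul_rpow_neg hA hB hAB hpos hint
  have hmem_n : Tn ∈ Set.Icc Tn Tn1 := Set.left_mem_Icc.2 hT.le
  have hmem_n1 : Tn1 ∈ Set.Icc Tn Tn1 := Set.right_mem_Icc.2 hT.le
  have hmono : MonotoneOn γf (Set.Icc Tn Tn1) := by
    intro S hS T hT' hST
    refine (hanti.le_iff_ge (hγf T hT').1.1 (hγf S hS).1.1).1 ?_
    simp only [(hγf S hS).2, (hγf T hT').2]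
    exact hB₀anti.antitoneOn hS hT' hST
  have hγn : γf Tn = 0 := by
    refine hanti.injOn (hγf Tn hmem_n).1.1 Set.self_mem_Ici ?_
    simp only [(hγf Tn hmem_n).2, hB₀n]
    simp [rpow_neg_one]
  have hγn1 : γf Tn1 = 1 := by
    refine hanti.injOn (hγf Tn1 hmem_n1).1.1 (Set.mem_Ici.2 zero_le_one) ?_
    simp only [(hγf Tn1 hmem_n1).2, hB₀n1]
    simp [rpow_neg_one]
  filter_upwards [hAB] with ω ⟨ha, hab⟩
  have hpath := monotone_rpow_mul_rpow ha hab
  refine ⟨hpath.comp_monotoneOn hmono, fun T hT' => ⟨?_, ?_⟩, ?_, ?_⟩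
  · simpa using hpath (hγf T hT').1.1
  · simpa using hpath (hγf T hT').1.2
  · simp [hγn]
  · simp [hγn1]
end
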